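/- Let ρ : ℝ × ℝ³ → ℝ and J : ℝ × ℝ³ → ℝ³ be smooth and satisfy the continuity equation ∂ρ/∂t + div J = 0. Assume (ρ, J) is strongly non-radiating: for every v ∈ ℝ³ with |v| < c there exist smooth E', B' : ℝ × ℝ³ → ℝ³ such that (ρ'_v, J'_v, E', B') satisfies Maxwell's equations and E' = 0 identically. Then (ρ, J) is trivial: ρ = 0 and J = 0 identically. -/

import Mathlib

noncomputable section

open Real MeasureTheory Filter

/-- Physical space `ℝ³`. -/
abbrev V3 : Type := Fin 3 → ℝ

/-- Partial derivative with respect to the time variable. -/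
def ptd {E : Type} [NormedAddCommGroup E] [NormedSpace ℝ E]
    (f : ℝ × V3 → E) : ℝ × V3 → E :=
  fun p => deriv (fun s => f (s, p.2)) p.1

/-- Partial derivative in the `i`-th spatial direction. -/
def pxd {E : Type} [NormedAddCommGroup E] [NormedSpace ℝ E]
    (i : Fin 3) (f : ℝ × V3 → E) : ℝ × V3 → E :=
  fun p => fderiv ℝ (fun y => f (p.1, y)) p.2 (Pi.single i (1 : ℝ))

/-- Spatial Laplacian. -/
def lap {E : Type} [NormedAddCommGroup E] [NormedSpace ℝ E]
    (f : ℝ × V3 → E) : ℝ × V3 → E :=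
  fun p => ∑ i : Fin 3, pxd i (pxd i f) p

/-- Spatial divergence of a vector field. -/
def divg (F : ℝ × V3 → V3) : ℝ × V3 → ℝ :=
  fun p => ∑ i : Fin 3, pxd i (fun q => F q i) p

/-- Spatial curl of a vector field. -/
def curl (F : ℝ × V3 → V3) : ℝ × V3 → V3 :=
  fun p => ![pxd 1 (fun q => F q 2) p - pxd 2 (fun q => F q 1) p,
             pxd 2 (fun q => F q 0) p - pxd 0 (fun q => F q 2) p,
             pxd 0 (fun q => F q 1) p - pxd 1 (fun q => F q 0) p]

/-- Spatial gradient of a scalar field. -/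
def grad (f : ℝ × V3 → ℝ) : ℝ × V3 → V3 :=
  fun p i => pxd i f p

/-- The d'Alembertian `□² = Δ - μ₀ε₀ ∂²/∂t²`. -/
def box (μ₀ ε₀ : ℝ) {E : Type} [NormedAddCommGroup E] [NormedSpace ℝ E]
    (f : ℝ × V3 → E) : ℝ × V3 → E :=
  fun p => lap f p - (μ₀ * ε₀) • ptd (ptd f) p

/-- Maxwell's equations for charge `ρ`, current `J` and fields `E`, `B`. -/
def Maxwell (ε₀ μ₀ : ℝ) (ρ : ℝ × V3 → ℝ) (J E B : ℝ × V3 → V3) : Prop :=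
  ∀ p : ℝ × V3,
    divg E p = ρ p / ε₀ ∧ divg B p = 0 ∧
    curl E p = -(ptd B p) ∧
    curl B p = μ₀ • J p + (μ₀ * ε₀) • ptd E p

/-- `f` is Schwartz in the spatial variable, locally uniformly in time. -/
def SchwartzLocUnif {E : Type} [NormedAddCommGroup E] [NormedSpace ℝ E]
    (f : ℝ × V3 → E) : Prop :=
  ∀ (α β : Fin 3 → ℕ) (j : ℕ) (R : ℝ), ∃ C : ℝ, ∀ p : ℝ × V3, |p.1| ≤ R →
    |∏ i : Fin 3, p.2 i ^ α i| *
      ‖(ptd^[j] ((pxd 0)^[β 0] ((pxd 1)^[β 1] ((pxd 2)^[β 2] f)))) p‖ ≤ C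

/-- Euclidean norm on `ℝ³`. -/
def norm3 (x : V3) : ℝ := Real.sqrt (∑ i : Fin 3, x i ^ 2)

/-- Dot product on `ℝ³`. -/
def dot3 (x y : V3) : ℝ := ∑ i : Fin 3, x i * y i

/-- Cross product on `ℝ³`. -/
def cross3 (a b : V3) : V3 :=
  ![a 1 * b 2 - a 2 * b 1, a 2 * b 0 - a 0 * b 2, a 0 * b 1 - a 1 * b 0]

/-- The Lorentz factor `γ_v`. -/
def gam (c : ℝ) (v : V3) : ℝ := 1 / Real.sqrt (1 - norm3 v ^ 2 / c ^ 2)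

/-- The Lorentz boost `Λ_v` with velocity `v`. -/
def boost (c : ℝ) (v : V3) (p : ℝ × V3) : ℝ × V3 :=
  (gam c v * (p.1 - dot3 v p.2 / c ^ 2),
   p.2 + ((gam c v - 1) * dot3 v p.2 / norm3 v ^ 2 - gam c v * p.1) • v)

/-- Transformed charge `ρ'_v`, i.e. the function with
`ρ'_v (Λ_v p) = γ_v (ρ p - v·J p / c²)`. -/
def rhoTr (c : ℝ) (v : V3) (ρ : ℝ × V3 → ℝ) (J : ℝ × V3 → V3) : ℝ × V3 → ℝ :=
  fun p => gam c v * (ρ (boost c (-v) p) - dot3 v (J (boost c (-v) p)) / c ^ 2)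

/-- Transformed current `J'_v`, i.e. the function with
`J'_v (Λ_v p) = J p + ((γ_v - 1)(v·J p)/|v|² - γ_v ρ p) v`. -/
def JTr (c : ℝ) (v : V3) (ρ : ℝ × V3 → ℝ) (J : ℝ × V3 → V3) : ℝ × V3 → V3 :=
  fun p => J (boost c (-v) p) +
    ((gam c v - 1) * dot3 v (J (boost c (-v) p)) / norm3 v ^ 2
      - gam c v * ρ (boost c (-v) p)) • v

/-- Transformed electric field `E''_v`, i.e. the function with
`E''_v (Λ_v p) = E_∥ p + γ_v E_⊥ p`. -/
def ETr (c : ℝ) (v : V3) (E : ℝ × V3 → V3) : ℝ × V3 → V3 :=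
  fun p =>
    (dot3 (E (boost c (-v) p)) v / norm3 v ^ 2) • v +
    gam c v • (E (boost c (-v) p) - (dot3 (E (boost c (-v) p)) v / norm3 v ^ 2) • v)

/-- Spatial gradient of a complex scalar field. -/
def gradC (f : ℝ × V3 → ℂ) : ℝ × V3 → Fin 3 → ℂ :=
  fun p i => pxd i f p

/-- Spatial divergence of a complex vector field. -/
def divgC (F : ℝ × V3 → Fin 3 → ℂ) : ℝ × V3 → ℂ :=
  fun p => ∑ i : Fin 3, pxd i (fun q => F q i) p

lemma norm3_sq (v : V3) : norm3 v ^ 2 = dot3 v v := by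
  rw [norm3, Real.sq_sqrt (Finset.sum_nonneg fun i _ => sq_nonneg (v i)), dot3]
  exact Finset.sum_congr rfl fun i _ => sq (v i)

lemma norm3_neg (v : V3) : norm3 (-v) = norm3 v := by
  simp [norm3]

lemma gam_neg (c : ℝ) (v : V3) : gam c (-v) = gam c v := by
  simp [gam, norm3_neg]

lemma one_sub_norm3_sq_div_pos {c : ℝ} {v : V3} (hc : 0 < c) (hv : norm3 v < c) :
    0 < 1 - norm3 v ^ 2 / c ^ 2 := by
  rw [sub_pos, div_lt_one (by positivity)]
  exact pow_lt_pow_left₀ hv (Real.sqrt_nonneg _) two_ne_zero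

lemma gam_pos {c : ℝ} {v : V3} (hc : 0 < c) (hv : norm3 v < c) : 0 < gam c v :=
  one_div_pos.2 (Real.sqrt_pos.2 (one_sub_norm3_sq_div_pos hc hv))

lemma gam_sq_mul {c : ℝ} {v : V3} (hc : 0 < c) (hv : norm3 v < c) :
    gam c v ^ 2 * (1 - norm3 v ^ 2 / c ^ 2) = 1 := by
  have h := one_sub_norm3_sq_div_pos hc hv
  rw [gam, div_pow, Real.sq_sqrt h.le, one_pow, one_div, inv_mul_cancel₀ h.ne']

lemma dot3_neg_left (v x : V3) : dot3 (-v) x = -dot3 v x := by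
  simp [dot3]

lemma dot3_add_smul (v x w : V3) (a : ℝ) :
    dot3 v (x + a • w) = dot3 v x + a * dot3 v w := by
  simp only [dot3, Fin.sum_univ_three, Pi.add_apply, Pi.smul_apply, smul_eq_mul]
  ring

lemma boost_zero (c : ℝ) (p : ℝ × V3) : boost c 0 p = p := by
  simp [boost, gam, norm3, dot3]

/-- Boosts with opposite velocities are inverse to each other. -/
lemma boost_neg_boost {c : ℝ} {v : V3} (hc : 0 < c) (hv : norm3 v < c) (p : ℝ × V3) :
    boost c (-v) (boost c v p) = p := by
  rcases eq_or_ne v 0 with rfl | hv0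
  · simp [boost_zero]
  have hn : dot3 v v ≠ 0 := fun h => hv0 (dotProduct_self_eq_zero.1 h)
  have hg := gam_sq_mul hc hv
  have hc0 := hc.ne'
  simp only [boost, gam_neg, norm3_neg, dot3_neg_left, dot3_add_smul]
  rw [norm3_sq] at hg ⊢
  generalize gam c v = g at *
  generalize dot3 v v = n at *
  obtain ⟨t, x⟩ := p
  dsimp only
  generalize dot3 v x = d
  field_simp at hg
  refine Prod.ext ?_ ?_
  · field_simp
    linear_combination t * hg
  · dsimp only
    rw [add_assoc, smul_neg, ← sub_eq_add_neg, ← sub_smul, add_eq_left]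
    refine smul_eq_zero_of_left ?_ v
    field_simp
    linear_combination d * hg

/-- If the transformed fields solve Maxwell's equations with vanishing electric field, then the
transformed charge density vanishes, that is, `ρ = v·J / c²`. -/
lemma rho_eq_dot3_div_of_maxwell {ε₀ μ₀ c : ℝ} (hε : 0 < ε₀) (hc : 0 < c)
    {ρ : ℝ × V3 → ℝ} {J E B : ℝ × V3 → V3} {v : V3} (hv : norm3 v < c)
    (hM : Maxwell ε₀ μ₀ (rhoTr c v ρ J) (JTr c v ρ J) E B) (hE : ∀ p, E p = 0)
    (p : ℝ × V3) : ρ p = dot3 v (J p) / c ^ 2 := by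
  have h := (hM (boost c v p)).1
  obtain rfl : E = fun _ => 0 := funext hE
  have h0 : divg (fun _ => 0) (boost c v p) = 0 := by simp [divg, pxd]
  rw [h0, eq_comm, div_eq_zero_iff, or_iff_left hε.ne', rhoTr, boost_neg_boost hc hv,
    mul_eq_zero, or_iff_right (gam_pos hc hv).ne', sub_eq_zero] at h
  exact h

/-- a strongly non-radiating charge/current pair (in every
inertial frame the transformed pair extends to a Maxwell solution with
vanishing electric field) is trivial. -/
theorem stmt_14 (ε₀ μ₀ c : ℝ) (hε : 0 < ε₀) (hμ : 0 < μ₀)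
    (hc : c = 1 / Real.sqrt (μ₀ * ε₀))
    (ρ : ℝ × V3 → ℝ) (J : ℝ × V3 → V3)
    (hρ : ContDiff ℝ (⊤ : ℕ∞) ρ) (hJ : ContDiff ℝ (⊤ : ℕ∞) J)
    (hcont : ∀ p : ℝ × V3, ptd ρ p + divg J p = 0)
    (hsnr : ∀ v : V3, norm3 v < c →
      ∃ E' B' : ℝ × V3 → V3,
        ContDiff ℝ (⊤ : ℕ∞) E' ∧ ContDiff ℝ (⊤ : ℕ∞) B' ∧
        Maxwell ε₀ μ₀ (rhoTr c v ρ J) (JTr c v ρ J) E' B' ∧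
        ∀ p : ℝ × V3, E' p = 0) :
    (∀ p : ℝ × V3, ρ p = 0) ∧ (∀ p : ℝ × V3, J p = 0) := by
  have hc0 : 0 < c := hc ▸ one_div_pos.2 (Real.sqrt_pos.2 (mul_pos hμ hε))
  have key : ∀ v : V3, norm3 v < c → ∀ p, ρ p = dot3 v (J p) / c ^ 2 := fun v hv => by
    obtain ⟨E', B', -, -, hM, hE⟩ := hsnr v hv
    exact rho_eq_dot3_div_of_maxwell hε hc0 hv hM hE
  have hρ0 : ∀ p, ρ p = 0 := fun p => by
    simpa [dot3] using key 0 (by simpa [norm3] using hc0) p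
  refine ⟨hρ0, fun p => funext fun i => ?_⟩
  have hv : norm3 (Pi.single i (c / 2)) < c := by
    rw [norm3, Finset.sum_eq_single i (by simp +contextual) (by simp), Pi.single_eq_same,
      Real.sqrt_sq (half_pos hc0).le]
    exact half_lt_self hc0
  have h := key _ hv p
  have hd : dot3 (Pi.single i (c / 2)) (J p) = c / 2 * J p i := single_dotProduct ..
  rw [hρ0, hd] at h
  simpa [hc0.ne'] using h.symm
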